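/- arXiv:1305.6080 — 4 statements merged into one kernel-verified Lean document; each statement's English description precedes it below -/
import Mathlib

section
/- If ψ is an alphabetic variant of the 𝓛-formula φ (ψ is obtained from φ by renaming bound variables so as to respect the binding of the quantifiers), then the biconditional φ ↔ ψ is a valid 𝓛-formula. -/
/-!
Formalization of the framework of "A machine that knows its own code" (S. Alexander).

The language 𝓛 is the language of Peano arithmetic (constant `0`, unary successor `S`,
binary `+` and `·`) extended by a unary modal operator `K`.
-/

/-- Terms of the language 𝓛 of Peano arithmetic (variables are indexed by `ℕ`). -/
inductive LTerm : Type
  | var : ℕ → LTerm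
  | zero : LTerm
  | succ : LTerm → LTerm
  | add : LTerm → LTerm → LTerm
  | mul : LTerm → LTerm → LTerm
  deriving DecidableEq

/-- Formulas of 𝓛: atomic equalities, falsum, implication, universal quantification,
and the modal operator `K`.  Other connectives and `∃` are defined below. -/
inductive LFormula : Type
  | eq : LTerm → LTerm → LFormula
  | falsum : LFormula
  | imp : LFormula → LFormula → LFormula
  | all : ℕ → LFormula → LFormula
  | K : LFormula → LFormula
  deriving DecidableEq

namespace LTerm

/-- Variables occurring in a term. -/
def fv : LTerm → Finset ℕ
  | var n => {n}
  | zero => ∅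
  | succ t => t.fv
  | add t u => t.fv ∪ u.fv
  | mul t u => t.fv ∪ u.fv

/-- Simultaneous substitution of terms for variables in a term. -/
def subst (s : ℕ → LTerm) : LTerm → LTerm
  | var n => s n
  | zero => zero
  | succ t => succ (t.subst s)
  | add t u => add (t.subst s) (u.subst s)
  | mul t u => mul (t.subst s) (u.subst s)

end LTerm

/-- The numeral `n̄` for a natural number `n`. -/
def numeral : ℕ → LTerm
  | 0 => LTerm.zero
  | n + 1 => LTerm.succ (numeral n)

namespace LFormula

/-- The free variables of a formula (the free variables of `K φ` are those of `φ`). -/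
def fv : LFormula → Finset ℕ
  | eq t u => t.fv ∪ u.fv
  | falsum => ∅
  | imp a b => a.fv ∪ b.fv
  | all x a => a.fv.erase x
  | K a => a.fv

/-- Simultaneous substitution of terms for the *free* variables of a formula
(bound variables are left untouched; the substitution is not capture-avoiding). -/
def subst (s : ℕ → LTerm) : LFormula → LFormula
  | eq t u => eq (t.subst s) (u.subst s)
  | falsum => falsum
  | imp a b => imp (a.subst s) (b.subst s)
  | all x a => all x (a.subst fun z => if z = x then LTerm.var x else s z)
  | K a => K (a.subst s)

end LFormula

/-- `subst1 x t φ` is `φ(x|t)`, the result of substituting the term `t` for the free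
occurrences of the variable `x` in `φ`. -/
def subst1 (x : ℕ) (t : LTerm) (φ : LFormula) : LFormula :=
  φ.subst fun z => if z = x then t else LTerm.var z

/-- `instNum s φ` is `φ^s`: the sentence obtained from `φ` by replacing each free
variable `x` of `φ` by the numeral for `s x`. -/
def instNum (s : ℕ → ℕ) (φ : LFormula) : LFormula :=
  φ.subst fun z => numeral (s z)

/-- `SubstitutableVar y x φ`: the variable `y` is substitutable for the variable `x`
in `φ` (no free occurrence of `x` lies within the scope of a quantifier binding `y`). -/
def SubstitutableVar (y x : ℕ) : LFormula → Prop
  | .eq _ _ => True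
  | .falsum => True
  | .imp a b => SubstitutableVar y x a ∧ SubstitutableVar y x b
  | .all z a => x ∉ (LFormula.all z a).fv ∨ (y ≠ z ∧ SubstitutableVar y x a)
  | .K a => SubstitutableVar y x a

/-- Correspondence of variables relative to a list of pairs of bound variables. -/
def VarCorr : List (ℕ × ℕ) → ℕ → ℕ → Prop
  | [], x, y => x = y
  | (a, b) :: Γ, x, y => (x = a ∧ y = b) ∨ (x ≠ a ∧ y ≠ b ∧ VarCorr Γ x y)

/-- Alpha-correspondence of terms relative to a list of pairs of bound variables. -/
def TermAlpha (Γ : List (ℕ × ℕ)) : LTerm → LTerm → Prop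
  | .var x, .var y => VarCorr Γ x y
  | .zero, .zero => True
  | .succ t, .succ u => TermAlpha Γ t u
  | .add t₁ t₂, .add u₁ u₂ => TermAlpha Γ t₁ u₁ ∧ TermAlpha Γ t₂ u₂
  | .mul t₁ t₂, .mul u₁ u₂ => TermAlpha Γ t₁ u₁ ∧ TermAlpha Γ t₂ u₂
  | _, _ => False

/-- Alpha-correspondence of formulas relative to a list of pairs of bound variables. -/
def FormulaAlpha : List (ℕ × ℕ) → LFormula → LFormula → Prop
  | Γ, .eq t₁ t₂, .eq u₁ u₂ => TermAlpha Γ t₁ u₁ ∧ TermAlpha Γ t₂ u₂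
  | _, .falsum, .falsum => True
  | Γ, .imp a₁ a₂, .imp b₁ b₂ => FormulaAlpha Γ a₁ b₁ ∧ FormulaAlpha Γ a₂ b₂
  | Γ, .all x a, .all y b => FormulaAlpha ((x, y) :: Γ) a b
  | Γ, .K a, .K b => FormulaAlpha Γ a b
  | _, _, _ => False

/-- `ψ` is an alphabetic variant of `φ`: `ψ` is obtained from `φ` by renaming bound
variables so as to respect the binding of the quantifiers. -/
def AlphaVariant (φ ψ : LFormula) : Prop := FormulaAlpha [] φ ψ

/-- Negation, defined from `→` and `⊥`. -/
def notF (φ : LFormula) : LFormula := LFormula.imp φ LFormula.falsum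

/-- Conjunction (defined connective). -/
def andF (φ ψ : LFormula) : LFormula := notF (LFormula.imp φ (notF ψ))

/-- Biconditional (defined connective). -/
def iffF (φ ψ : LFormula) : LFormula := andF (LFormula.imp φ ψ) (LFormula.imp ψ φ)

/-- Existential quantification (defined). -/
def exF (x : ℕ) (φ : LFormula) : LFormula := notF (LFormula.all x (notF φ))

/-- A canonical universal closure of a formula. -/
def uclose (φ : LFormula) : LFormula :=
  (φ.fv.sort (· ≤ ·)).foldr LFormula.all φ

/-- An 𝓛-structure: a first-order structure for the first-order part of 𝓛, together
with a truth assignment `satK s φ` for the purely modal formulas `K φ` at each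
assignment `s` into the universe (the three required constraints are singled out
in `IsLStructure` below). -/
structure LStructure where
  U : Type
  nonempty : Nonempty U
  zero : U
  succ : U → U
  add : U → U → U
  mul : U → U → U
  satK : (ℕ → U) → LFormula → Prop

namespace LStructure

/-- Value of a term under an assignment. -/
def evalT (M : LStructure) (s : ℕ → M.U) : LTerm → M.U
  | .var n => s n
  | .zero => M.zero
  | .succ t => M.succ (M.evalT s t)
  | .add t u => M.add (M.evalT s t) (M.evalT s u)
  | .mul t u => M.mul (M.evalT s t) (M.evalT s u)

/-- Satisfaction `M ⊨ φ[s]`, defined by the usual induction on formula complexity,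
with `M ⊨ (K φ)[s]` given by the structure's truth assignment `satK`. -/
def Sat (M : LStructure) : (ℕ → M.U) → LFormula → Prop
  | s, .eq t u => M.evalT s t = M.evalT s u
  | _, .falsum => False
  | s, .imp a b => M.Sat s a → M.Sat s b
  | s, .all x a => ∀ u : M.U, M.Sat (Function.update s x u) a
  | s, .K a => M.satK s a

/-- `M ⊨ φ`: `M ⊨ φ[s]` for every assignment `s`. -/
def Models (M : LStructure) (φ : LFormula) : Prop := ∀ s : ℕ → M.U, M.Sat s φ

end LStructure

/-- The three constraints making an `LStructure` a genuine 𝓛-structure of the base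
logic: (a) `satK s φ` depends only on the values of `s` on the free variables of `φ`;
(b) invariance under alphabetic variants; (c) weak substitution. -/
def IsLStructure (M : LStructure) : Prop :=
  (∀ (φ : LFormula) (s t : ℕ → M.U), (∀ x ∈ φ.fv, s x = t x) →
      (M.satK s φ ↔ M.satK t φ)) ∧
  (∀ (φ ψ : LFormula) (s : ℕ → M.U), AlphaVariant φ ψ →
      (M.satK s φ ↔ M.satK s ψ)) ∧
  (∀ (φ : LFormula) (x y : ℕ) (s : ℕ → M.U), SubstitutableVar y x φ →
      (M.satK s (subst1 x (LTerm.var y) φ) ↔ M.satK (Function.update s x (s y)) φ))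

/-- `Σ ⊨ φ`: every 𝓛-structure satisfying every member of `Σ` satisfies `φ`. -/
def Consequence (T : Set LFormula) (φ : LFormula) : Prop :=
  ∀ M : LStructure, IsLStructure M → (∀ σ ∈ T, M.Models σ) → M.Models φ

/-- `φ` is valid: `∅ ⊨ φ`, i.e. `φ` holds in every 𝓛-structure under every assignment. -/
def Valid (φ : LFormula) : Prop := Consequence ∅ φ

/-- The structure `M_Σ`: universe `ℕ`, standard interpretations of the symbols of
Peano arithmetic, and `M_Σ ⊨ (K φ)[s]` iff `Σ ⊨ φ^s`. -/
def MSigma (T : Set LFormula) : LStructure where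
  U := ℕ
  nonempty := ⟨0⟩
  zero := 0
  succ := Nat.succ
  add := (· + ·)
  mul := (· * ·)
  satK := fun s φ => Consequence T (instNum s φ)

/-- Instances of the schema `E1`: the universal closure of `K φ` for valid `φ`. -/
def E1set : Set LFormula :=
  {χ | ∃ φ : LFormula, Valid φ ∧ χ = uclose (LFormula.K φ)}

/-- Instances of the schema `E2`: the universal closure of `K(φ → ψ) → K φ → K ψ`. -/
def E2set : Set LFormula :=
  {χ | ∃ φ ψ : LFormula,
    χ = uclose (LFormula.imp (LFormula.K (LFormula.imp φ ψ))
      (LFormula.imp (LFormula.K φ) (LFormula.K ψ)))}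

/-- Instances of the schema `E3` (factivity): the universal closure of `K φ → φ`. -/
def E3set : Set LFormula :=
  {χ | ∃ φ : LFormula, χ = uclose (LFormula.imp (LFormula.K φ) φ)}

/-- Instances of the schema `E4`: the universal closure of `K φ → K K φ`. -/
def E4set : Set LFormula :=
  {χ | ∃ φ : LFormula, χ = uclose (LFormula.imp (LFormula.K φ) (LFormula.K (LFormula.K φ)))}

/-- The axioms of Peano arithmetic for 𝓛: the six usual axioms for successor,
addition and multiplication, and the induction schema extended to all 𝓛-formulas. -/
inductive PAax : LFormula → Prop
  | succ_ne_zero : PAax (.all 0 (notF (.eq (.succ (.var 0)) .zero)))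
  | succ_inj : PAax (.all 0 (.all 1 (.imp (.eq (.succ (.var 0)) (.succ (.var 1)))
      (.eq (.var 0) (.var 1)))))
  | add_zero : PAax (.all 0 (.eq (.add (.var 0) .zero) (.var 0)))
  | add_succ : PAax (.all 0 (.all 1 (.eq (.add (.var 0) (.succ (.var 1)))
      (.succ (.add (.var 0) (.var 1))))))
  | mul_zero : PAax (.all 0 (.eq (.mul (.var 0) .zero) .zero))
  | mul_succ : PAax (.all 0 (.all 1 (.eq (.mul (.var 0) (.succ (.var 1)))
      (.add (.mul (.var 0) (.var 1)) (.var 0)))))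
  | ind (φ : LFormula) (x : ℕ) :
      PAax (uclose (.imp (subst1 x .zero φ)
        (.imp (.all x (.imp φ (subst1 x (.succ (.var x)) φ))) (.all x φ))))

/-- The set of axioms of Peano arithmetic for 𝓛. -/
def PAset : Set LFormula := {φ | PAax φ}

/-- `W e`: the `e`-th recursively enumerable subset of `ℕ` (the domain of the `e`-th
partial computable function). -/
def W (e : ℕ) : Set ℕ :=
  {m | ((Denumerable.ofNat Nat.Partrec.Code e).eval m).Dom}

namespace LTerm

/-- A canonical Gödel numbering of terms. -/
def gnum : LTerm → ℕ
  | var n => Nat.pair 0 n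
  | zero => Nat.pair 1 0
  | succ t => Nat.pair 2 t.gnum
  | add t u => Nat.pair 3 (Nat.pair t.gnum u.gnum)
  | mul t u => Nat.pair 4 (Nat.pair t.gnum u.gnum)

end LTerm

namespace LFormula

/-- A canonical Gödel numbering `⌜φ⌝` of formulas. -/
def gnum : LFormula → ℕ
  | eq t u => Nat.pair 0 (Nat.pair t.gnum u.gnum)
  | falsum => Nat.pair 1 0
  | imp a b => Nat.pair 2 (Nat.pair a.gnum b.gnum)
  | all x a => Nat.pair 3 (Nat.pair x a.gnum)
  | K a => Nat.pair 4 a.gnum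

end LFormula

/-- The designated variable `x`. -/
def vx : ℕ := 0
/-- The designated variable `y` (second pairing argument). -/
def vy : ℕ := 1
/-- The designated variable `e` (r.e. index). -/
def ve : ℕ := 2

/-- A formula is `K`-free (purely first-order) if the operator `K` does not occur in it. -/
def KFree : LFormula → Prop
  | .eq _ _ => True
  | .falsum => True
  | .imp a b => KFree a ∧ KFree b
  | .all _ a => KFree a
  | .K _ => False

/-- The standard structure: universe `ℕ` with the standard interpretations of the
symbols of Peano arithmetic (the modal component is irrelevant for `K`-free formulas). -/
def StdModel : LStructure where
  U := ℕ
  nonempty := ⟨0⟩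
  zero := 0
  succ := Nat.succ
  add := (· + ·)
  mul := (· * ·)
  satK := fun _ _ => False

/-- `pwNum pw a b k`: the result of substituting the numerals `ā`, `b̄`, `k̄` for the
designated variables `x`, `y`, `e` in the formula `pw` (read: `⟨ā, b̄⟩ ∈ W_k̄`). -/
def pwNum (pw : LFormula) (a b k : ℕ) : LFormula :=
  instNum (fun z => if z = vx then a else if z = vy then b else k) pw

/-- `wNum w a k`: the result of substituting the numerals `ā`, `k̄` for the designated
variables `x`, `e` in the formula `w` (read: `ā ∈ W_k̄`). -/
def wNum (w : LFormula) (a k : ℕ) : LFormula :=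
  instNum (fun z => if z = vx then a else k) w

/-- Line 3 of the definition of `Σ(n)`: the sentence
`∀x (K φ ↔ ⟨x, ⌜φ⌝⟩ ∈ W_n̄)`, where `pw` is the formula (with designated free
variables `x`, `y`, `e`) expressing `⟨x, y⟩ ∈ W_e`. -/
def line3 (pw : LFormula) (n : ℕ) (φ : LFormula) : LFormula :=
  LFormula.all vx (iffF (LFormula.K φ)
    (subst1 ve (numeral n) (subst1 vy (numeral φ.gnum) pw)))

/-- Membership in the axiom set `Σ(n)` (relative to the formula `pw` expressing
`⟨x, y⟩ ∈ W_e`): (1) instances of `E1`, `E2`, `E4`; (2) the axioms of Peano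
arithmetic for 𝓛; (3) `∀x (K φ ↔ ⟨x, ⌜φ⌝⟩ ∈ W_n̄)` for `φ` with free variables
⊆ {x}; (4) assigned validity `φ^s` for valid `φ`; (5) `K φ` for `φ` an instance of
lines 1–4 or, recursively, of line 5. -/
inductive SigmaAx (pw : LFormula) (n : ℕ) : LFormula → Prop
  | e1 {χ : LFormula} (h : χ ∈ E1set) : SigmaAx pw n χ
  | e2 {χ : LFormula} (h : χ ∈ E2set) : SigmaAx pw n χ
  | e4 {χ : LFormula} (h : χ ∈ E4set) : SigmaAx pw n χ
  | pa {χ : LFormula} (h : PAax χ) : SigmaAx pw n χ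
  | code (φ : LFormula) (h : φ.fv ⊆ {vx}) : SigmaAx pw n (line3 pw n φ)
  | av (φ : LFormula) (s : ℕ → ℕ) (h : Valid φ) : SigmaAx pw n (instNum s φ)
  | k {φ : LFormula} (h : SigmaAx pw n φ) : SigmaAx pw n (LFormula.K φ)

/-- The axiom set `Σ(n)` (relative to `pw`). -/
def SigmaN (pw : LFormula) (n : ℕ) : Set LFormula := {φ | SigmaAx pw n φ}

/-- The set `{ ⟨m, ⌜φ⌝⟩ : φ an 𝓛-formula with free variables ⊆ {x} and
Σ(n) ⊨ φ(x|m̄) }`. -/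
def goalSet (pw : LFormula) (n : ℕ) : Set ℕ :=
  {p | ∃ (m : ℕ) (φ : LFormula), p = Nat.pair m φ.gnum ∧ φ.fv ⊆ {vx} ∧
    Consequence (SigmaN pw n) (subst1 vx (numeral m) φ)}

/-- The variables bound by some quantifier of a formula. -/
def LFormula.bv : LFormula → Finset ℕ
  | eq _ _ => ∅
  | falsum => ∅
  | imp a b => a.bv ∪ b.bv
  | all x a => insert x a.bv
  | K a => a.bv

theorem substitutableVar_of_notMem_bv {z : ℕ} (x : ℕ) {φ : LFormula} (hz : z ∉ φ.bv) :
    SubstitutableVar z x φ := by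
  induction φ with
  | eq | falsum => trivial
  | imp a b iha ihb =>
    simp only [LFormula.bv, Finset.mem_union, not_or] at hz
    exact ⟨iha hz.1, ihb hz.2⟩
  | all p a ih =>
    simp only [LFormula.bv, Finset.mem_insert, not_or] at hz
    exact Or.inr ⟨hz.1, ih hz.2⟩
  | K a ih => exact ih hz

theorem LTerm.exists_of_mem_fv_subst {σ : ℕ → LTerm} {t : LTerm} {w : ℕ}
    (hw : w ∈ (t.subst σ).fv) : ∃ u ∈ t.fv, w ∈ (σ u).fv := by
  induction t with
  | var n => exact ⟨n, Finset.mem_singleton_self n, hw⟩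
  | zero => simp [LTerm.subst, LTerm.fv] at hw
  | succ t ih => exact ih hw
  | add t₁ t₂ ih₁ ih₂ | mul t₁ t₂ ih₁ ih₂ =>
    simp only [LTerm.subst, LTerm.fv, Finset.mem_union] at hw ⊢
    grind

theorem LFormula.exists_of_mem_fv_subst {σ : ℕ → LTerm} {φ : LFormula} {w : ℕ}
    (hw : w ∈ (φ.subst σ).fv) : ∃ u ∈ φ.fv, w ∈ (σ u).fv := by
  induction φ generalizing σ with
  | eq t₁ t₂ =>
    simp only [LFormula.subst, LFormula.fv, Finset.mem_union] at hw ⊢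
    rcases hw with hw | hw <;> obtain ⟨u, hu, h⟩ := LTerm.exists_of_mem_fv_subst hw <;> grind
  | falsum => simp [LFormula.subst, LFormula.fv] at hw
  | imp a b iha ihb =>
    simp only [LFormula.subst, LFormula.fv, Finset.mem_union] at hw ⊢
    rcases hw with hw | hw
    · obtain ⟨u, hu, h⟩ := iha hw
      exact ⟨u, Or.inl hu, h⟩
    · obtain ⟨u, hu, h⟩ := ihb hw
      exact ⟨u, Or.inr hu, h⟩
  | all p a ih =>
    simp only [LFormula.subst, LFormula.fv, Finset.mem_erase] at hw ⊢
    obtain ⟨hwp, hw⟩ := hw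
    obtain ⟨u, hu, h⟩ := ih hw
    by_cases hup : u = p
    · simp [hup, LTerm.fv, hwp] at h
    · exact ⟨u, ⟨hup, hu⟩, by simpa [hup] using h⟩
  | K a ih => exact ih hw

theorem eq_or_mem_fv_of_mem_fv_subst1_var {x z w : ℕ} {φ : LFormula}
    (hw : w ∈ (subst1 x (.var z) φ).fv) :
    (w = z ∧ x ∈ φ.fv) ∨ (w ≠ x ∧ w ∈ φ.fv) := by
  obtain ⟨u, hu, h⟩ := LFormula.exists_of_mem_fv_subst hw
  by_cases hux : u = x
  · exact Or.inl ⟨by simpa [hux, LTerm.fv] using h, hux ▸ hu⟩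
  · have : w = u := by simpa [hux, LTerm.fv] using h
    exact Or.inr (this ▸ ⟨hux, hu⟩)

theorem TermAlpha.subst {Γ Δ : List (ℕ × ℕ)} {σ τ : ℕ → LTerm}
    (hστ : ∀ u v, VarCorr Γ u v → TermAlpha Δ (σ u) (τ v)) {t u : LTerm}
    (h : TermAlpha Γ t u) : TermAlpha Δ (t.subst σ) (u.subst τ) := by
  induction t generalizing u with
  | var n => cases u <;> first | exact hστ _ _ h | exact h.elim
  | zero => cases u <;> trivial
  | succ t ih => cases u <;> first | exact ih h | exact h.elim
  | add t₁ t₂ ih₁ ih₂ | mul t₁ t₂ ih₁ ih₂ =>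
    cases u <;> first | exact ⟨ih₁ h.1, ih₂ h.2⟩ | exact h.elim

/-- Corresponding renamings of free variables, each moving variables only to `z`,
preserve alpha-correspondence as long as `z` is not bound. -/
theorem FormulaAlpha.subst {z : ℕ} {Γ Δ : List (ℕ × ℕ)} {σ τ : ℕ → LTerm} {φ ψ : LFormula}
    (hσ : ∀ u, σ u = .var u ∨ σ u = .var z) (hτ : ∀ u, τ u = .var u ∨ τ u = .var z)
    (hστ : ∀ u v, VarCorr Γ u v → TermAlpha Δ (σ u) (τ v))
    (hφ : z ∉ φ.bv) (hψ : z ∉ ψ.bv) (h : FormulaAlpha Γ φ ψ) :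
    FormulaAlpha Δ (φ.subst σ) (ψ.subst τ) := by
  induction φ generalizing ψ Γ Δ σ τ with
  | eq t₁ t₂ =>
    cases ψ <;> first | exact ⟨h.1.subst hστ, h.2.subst hστ⟩ | exact h.elim
  | falsum => cases ψ <;> trivial
  | imp a₁ a₂ ih₁ ih₂ =>
    cases ψ with
    | imp b₁ b₂ =>
      simp only [LFormula.bv, Finset.mem_union, not_or] at hφ hψ
      exact ⟨ih₁ hσ hτ hστ hφ.1 hψ.1 h.1, ih₂ hσ hτ hστ hφ.2 hψ.2 h.2⟩
    | _ => exact h.elim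
  | all p a ih =>
    cases ψ with
    | all q b =>
      simp only [LFormula.bv, Finset.mem_insert, not_or] at hφ hψ
      refine ih (Γ := (p, q) :: Γ) (Δ := (p, q) :: Δ) ?_ ?_ ?_ hφ.2 hψ.2 h
      · intro u
        by_cases hu : u = p <;> simp [hu, hσ]
      · intro u
        by_cases hu : u = q <;> simp [hu, hτ]
      · rintro u v (⟨rfl, rfl⟩ | ⟨hu, hv, huv⟩)
        · simp [TermAlpha, VarCorr]
        · have key := hστ u v huv
          rcases hσ u with h₁ | h₁ <;> rcases hτ v with h₂ | h₂ <;>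
            simp_all [TermAlpha, VarCorr]
    | _ => exact h.elim
  | K a ih => cases ψ <;> first | exact ih hσ hτ hστ hφ hψ h | exact h.elim

theorem varCorr_self {Γ : List (ℕ × ℕ)} {z : ℕ} (h₁ : z ∉ Γ.map Prod.fst)
    (h₂ : z ∉ Γ.map Prod.snd) : VarCorr Γ z z := by
  induction Γ with
  | nil => rfl
  | cons p Γ ih =>
    simp only [List.map_cons, List.mem_cons, not_or] at h₁ h₂
    exact Or.inr ⟨h₁.1, h₂.1, ih h₁.2 h₂.2⟩

theorem VarCorr.eq_iff_eq {Γ : List (ℕ × ℕ)} {u v z : ℕ} (h : VarCorr Γ u v)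
    (h₁ : z ∉ Γ.map Prod.fst) (h₂ : z ∉ Γ.map Prod.snd) : u = z ↔ v = z := by
  induction Γ with
  | nil => rw [show u = v from h]
  | cons p Γ ih =>
    simp only [List.map_cons, List.mem_cons, not_or] at h₁ h₂
    rcases h with ⟨rfl, rfl⟩ | ⟨-, -, h⟩
    · exact iff_of_false (Ne.symm h₁.1) (Ne.symm h₂.1)
    · exact ih h h₁.2 h₂.2

/-- Renaming a free variable `x` to a fresh variable `z` carrying the same value. -/
theorem IsLStructure.satK_subst1_fresh {M : LStructure} (hM : IsLStructure M) {φ : LFormula}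
    {x z : ℕ} (s : ℕ → M.U) (hfv : z ∉ φ.fv) (hbv : z ∉ φ.bv) :
    M.satK (Function.update s z (s x)) (subst1 x (.var z) φ) ↔ M.satK s φ := by
  rw [hM.2.2 φ x z _ (substitutableVar_of_notMem_bv x hbv)]
  refine hM.1 _ _ _ fun w hw => ?_
  have hwz : w ≠ z := fun h => hfv (h ▸ hw)
  by_cases hwx : w = x <;> simp [hwx, hwz]

theorem IsLStructure.satK_iff_of_formulaAlpha {M : LStructure} (hM : IsLStructure M)
    {Γ : List (ℕ × ℕ)} {φ ψ : LFormula} {s t : ℕ → M.U}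
    (hst : ∀ u ∈ φ.fv, ∀ v ∈ ψ.fv, VarCorr Γ u v → s u = t v) (h : FormulaAlpha Γ φ ψ) :
    M.satK s φ ↔ M.satK t ψ := by
  induction Γ generalizing φ ψ s t with
  | nil =>
    let r : ℕ → M.U := fun u => if u ∈ φ.fv then s u else t u
    rw [hM.1 φ s r fun u hu => by simp [r, hu], hM.2.1 φ ψ r h]
    refine hM.1 ψ r t fun u hu => ?_
    by_cases hu' : u ∈ φ.fv
    · simpa [r, hu'] using hst u hu' u hu rfl
    · simp [r, hu']
  | cons p Γ ih =>
    obtain ⟨x, y⟩ := p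
    obtain ⟨z, hz⟩ := Infinite.exists_notMem_finset
      (φ.fv ∪ φ.bv ∪ ψ.fv ∪ ψ.bv ∪ (Γ.map Prod.fst).toFinset ∪ (Γ.map Prod.snd).toFinset)
    simp only [Finset.mem_union, List.mem_toFinset, not_or] at hz
    obtain ⟨⟨⟨⟨⟨hφf, hφb⟩, hψf⟩, hψb⟩, hz₁⟩, hz₂⟩ := hz
    rw [← hM.satK_subst1_fresh (x := x) s hφf hφb, ← hM.satK_subst1_fresh (x := y) t hψf hψb]
    refine ih ?_ (FormulaAlpha.subst (z := z) ?_ ?_ ?_ hφb hψb h)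
    · intro u hu v hv huv
      have huvz := huv.eq_iff_eq hz₁ hz₂
      rcases eq_or_mem_fv_of_mem_fv_subst1_var hu with ⟨rfl, hx⟩ | ⟨hux, hu⟩
      · obtain rfl := huvz.1 rfl
        rcases eq_or_mem_fv_of_mem_fv_subst1_var hv with ⟨-, hy⟩ | ⟨-, hv⟩
        · simpa using hst x hx y hy (Or.inl ⟨rfl, rfl⟩)
        · exact absurd hv hψf
      · have huz : u ≠ z := fun h => hφf (h ▸ hu)
        have hvz : v ≠ z := fun h => huz (huvz.2 h)
        rcases eq_or_mem_fv_of_mem_fv_subst1_var hv with ⟨hv, -⟩ | ⟨hvy, hv⟩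
        · exact absurd hv hvz
        · simpa [huz, hvz] using hst u hu v hv (Or.inr ⟨hux, hvy, huv⟩)
    · intro u
      by_cases hu : u = x <;> simp [hu]
    · intro u
      by_cases hu : u = y <;> simp [hu]
    · rintro u v (⟨rfl, rfl⟩ | ⟨hu, hv, huv⟩)
      · simpa [TermAlpha] using varCorr_self hz₁ hz₂
      · simpa [TermAlpha, hu, hv] using huv

theorem LStructure.evalT_eq_of_termAlpha (M : LStructure) {Γ : List (ℕ × ℕ)} {t u : LTerm}
    {r s : ℕ → M.U} (hrs : ∀ u v, VarCorr Γ u v → r u = s v) (h : TermAlpha Γ t u) :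
    M.evalT r t = M.evalT s u := by
  induction t generalizing u with
  | var n => cases u <;> first | exact hrs _ _ h | exact h.elim
  | zero => cases u <;> first | rfl | exact h.elim
  | succ t ih => cases u <;> first | exact congrArg M.succ (ih h) | exact h.elim
  | add t₁ t₂ ih₁ ih₂ =>
    cases u <;> first | exact congrArg₂ M.add (ih₁ h.1) (ih₂ h.2) | exact h.elim
  | mul t₁ t₂ ih₁ ih₂ =>
    cases u <;> first | exact congrArg₂ M.mul (ih₁ h.1) (ih₂ h.2) | exact h.elim

theorem IsLStructure.sat_iff_of_formulaAlpha {M : LStructure} (hM : IsLStructure M)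
    {Γ : List (ℕ × ℕ)} {φ ψ : LFormula} {s t : ℕ → M.U}
    (hst : ∀ u v, VarCorr Γ u v → s u = t v) (h : FormulaAlpha Γ φ ψ) :
    M.Sat s φ ↔ M.Sat t ψ := by
  induction φ generalizing ψ Γ s t with
  | eq t₁ t₂ =>
    cases ψ with
    | eq u₁ u₂ =>
      simp only [LStructure.Sat, M.evalT_eq_of_termAlpha hst h.1,
        M.evalT_eq_of_termAlpha hst h.2]
    | _ => exact h.elim
  | falsum => cases ψ <;> first | exact Iff.rfl | exact h.elim
  | imp a₁ a₂ ih₁ ih₂ =>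
    cases ψ <;> first | exact imp_congr (ih₁ hst h.1) (ih₂ hst h.2) | exact h.elim
  | all x a ih =>
    cases ψ with
    | all y b =>
      refine forall_congr' fun c => ih (Γ := (x, y) :: Γ) ?_ h
      rintro u v (⟨rfl, rfl⟩ | ⟨hu, hv, huv⟩)
      · simp
      · simpa [hu, hv] using hst u v huv
    | _ => exact h.elim
  | K a ih =>
    cases ψ <;> first
      | exact hM.satK_iff_of_formulaAlpha (fun u _ v _ => hst u v) h
      | exact h.elim

/-- If ψ is an alphabetic variant of the 𝓛-formula φ, then the
biconditional φ ↔ ψ is a valid 𝓛-formula. -/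
theorem alphaVariant_iff_valid (φ ψ : LFormula) (h : AlphaVariant φ ψ) :
    Valid (iffF φ ψ) := by
  intro M hM _ s
  have key := hM.sat_iff_of_formulaAlpha (Γ := []) (s := s) (t := s)
    (fun _ _ huv => congrArg s huv) h
  simp only [iffF, andF, notF, LStructure.Sat]
  tauto
end

section
/- For any set Σ of 𝓛-sentences, any 𝓛-formula φ, and any assignment s into ℕ: M_Σ ⊨ φ[s] if and only if M_Σ ⊨ φ^s. -/
theorem numeral_subst (τ : ℕ → LTerm) (n : ℕ) : (numeral n).subst τ = numeral n := by
  induction n with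
  | zero => rfl
  | succ n ih => simp [numeral, LTerm.subst, ih]

theorem MSigma_evalT_numeral (T : Set LFormula) (t : ℕ → ℕ) (n : ℕ) :
    (MSigma T).evalT t (numeral n) = n := by
  induction n with
  | zero => rfl
  | succ n ih => exact congrArg Nat.succ ih

/-- A substitution which sends every variable to itself or to a numeral. -/
def IsNumeralSubst (σ : ℕ → LTerm) : Prop :=
  ∀ z, σ z = LTerm.var z ∨ ∃ n, σ z = numeral n

theorem IsNumeralSubst.bind {σ : ℕ → LTerm} (hσ : IsNumeralSubst σ) (x : ℕ) :
    IsNumeralSubst fun z => if z = x then LTerm.var x else σ z := by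
  intro z
  by_cases hz : z = x
  · simp [hz]
  · simpa [hz] using hσ z

theorem LTerm.subst_subst (σ τ : ℕ → LTerm) (t : LTerm) :
    (t.subst σ).subst τ = t.subst fun z => (σ z).subst τ := by
  induction t <;> simp_all [LTerm.subst]

theorem LFormula.subst_subst {σ : ℕ → LTerm} (hσ : IsNumeralSubst σ) (τ : ℕ → LTerm)
    (φ : LFormula) : (φ.subst σ).subst τ = φ.subst fun z => (σ z).subst τ := by
  induction φ generalizing σ τ with
  | eq t u => simp [LFormula.subst, LTerm.subst_subst]
  | falsum => rfl
  | imp a b iha ihb => simp [LFormula.subst, iha hσ, ihb hσ]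
  | K a ih => simp [LFormula.subst, ih hσ]
  | all x a ih =>
    simp only [LFormula.subst, ih (hσ.bind x)]
    congr 2
    funext z
    by_cases hz : z = x
    · simp [hz, LTerm.subst]
    · rcases hσ z with h | ⟨n, h⟩ <;> simp [hz, h, LTerm.subst, numeral_subst]

theorem LStructure.evalT_subst (M : LStructure) (σ : ℕ → LTerm) (t : ℕ → M.U) (u : LTerm) :
    M.evalT t (u.subst σ) = M.evalT (fun z => M.evalT t (σ z)) u := by
  induction u <;> simp_all [LTerm.subst, LStructure.evalT]

theorem MSigma_instNum_subst (T : Set LFormula) {σ : ℕ → LTerm} (hσ : IsNumeralSubst σ)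
    (t : ℕ → ℕ) (φ : LFormula) :
    instNum t (φ.subst σ) = instNum (fun z => (MSigma T).evalT t (σ z)) φ := by
  simp only [instNum, LFormula.subst_subst hσ]
  congr 1
  funext z
  rcases hσ z with h | ⟨n, h⟩
  · simp [h, LTerm.subst, LStructure.evalT]
  · rw [h, numeral_subst, MSigma_evalT_numeral]

theorem MSigma_sat_subst (T : Set LFormula) {σ : ℕ → LTerm} (hσ : IsNumeralSubst σ)
    (t : ℕ → ℕ) (φ : LFormula) :
    (MSigma T).Sat t (φ.subst σ) ↔ (MSigma T).Sat (fun z => (MSigma T).evalT t (σ z)) φ := by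
  induction φ generalizing σ t with
  | eq u v =>
    exact iff_of_eq (congrArg₂ Eq ((MSigma T).evalT_subst σ t u) ((MSigma T).evalT_subst σ t v))
  | falsum => rfl
  | imp a b iha ihb => simp only [LFormula.subst, LStructure.Sat, iha hσ, ihb hσ]
  | K a ih =>
    change Consequence T (instNum t (a.subst σ)) ↔ Consequence T (instNum _ a)
    rw [MSigma_instNum_subst T hσ]
  | all x a ih =>
    refine forall_congr' fun u => (ih (hσ.bind x) (Function.update t x u)).trans ?_
    refine iff_of_eq (congrArg (fun r => (MSigma T).Sat r a) (funext fun z => ?_))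
    by_cases hz : z = x
    · subst hz
      simp only [if_true, Function.update_self]
      exact Function.update_self z u t
    · rw [Function.update_of_ne hz]
      simp only [if_neg hz]
      rcases hσ z with h | ⟨n, h⟩
      · rw [h]
        exact Function.update_of_ne hz u t
      · rw [h]
        exact (MSigma_evalT_numeral T _ n).trans (MSigma_evalT_numeral T t n).symm

/-- For any set Σ of 𝓛-sentences, any 𝓛-formula φ, and any assignment s
into ℕ: `M_Σ ⊨ φ[s]` if and only if `M_Σ ⊨ φ^s`. -/
theorem MSigma_sat_iff_sat_instNum (T : Set LFormula) (hsent : ∀ σ ∈ T, σ.fv = ∅)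
    (φ : LFormula) (s : ℕ → ℕ) :
    (MSigma T).Sat s φ ↔ (MSigma T).Models (instNum s φ) := by
  have key (t : ℕ → ℕ) : (MSigma T).Sat t (instNum s φ) ↔ (MSigma T).Sat s φ := by
    have h := MSigma_sat_subst T (σ := fun z => numeral (s z)) (fun z => Or.inr ⟨s z, rfl⟩) t φ
    simp only [MSigma_evalT_numeral] at h
    exact h
  exact ⟨fun h t => (key t).2 h, fun h => (key s).1 (h s)⟩
end

section
/- For any set Σ of 𝓛-sentences, the structure M_Σ satisfies all instances of the schema E2, namely the universal closure of K(φ → ψ) → Kφ → Kψ for all 𝓛-formulas φ, ψ. -/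
theorem LStructure.Models.foldr_all {M : LStructure} {φ : LFormula} (h : M.Models φ)
    (l : List ℕ) : M.Models (l.foldr LFormula.all φ) := by
  induction l with
  | nil => exact h
  | cons x l ih => exact fun s u => ih (Function.update s x u)

theorem LStructure.Models.uclose {M : LStructure} {φ : LFormula} (h : M.Models φ) :
    M.Models (uclose φ) :=
  h.foldr_all _

theorem Consequence.mp {T : Set LFormula} {φ ψ : LFormula}
    (himp : Consequence T (LFormula.imp φ ψ)) (hφ : Consequence T φ) : Consequence T ψ :=
  fun M hM hT s => himp M hM hT s (hφ M hM hT s)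

/-- For any set Σ of 𝓛-sentences, the structure M_Σ satisfies all
instances of the schema E2, namely the universal closure of K(φ → ψ) → K φ → K ψ. -/
theorem MSigma_satisfies_E2 (T : Set LFormula) (hsent : ∀ σ ∈ T, σ.fv = ∅) :
    ∀ χ ∈ E2set, (MSigma T).Models χ := by
  rintro χ ⟨φ, ψ, rfl⟩
  exact LStructure.Models.uclose fun s himp hφ => Consequence.mp himp hφ
end

section
/- Suppose Σ is a set of 𝓛-sentences that is closed under K (for every φ ∈ Σ, also Kφ ∈ Σ) and contains all instances of E1 (the universal closure of Kφ whenever φ is valid) and E2 (the universal closure of K(φ → ψ) → Kφ → Kψ). Then M_Σ satisfies all instances of E4, the universal closure of Kφ → KKφ. -/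
open Filter in
/-- The ultraproduct of a family of structures along an ultrafilter. -/
noncomputable def LStructure.ultraproduct {ι : Type} (F : Ultrafilter ι) (M : ι → LStructure) :
    LStructure where
  U := Filter.Product (F : Filter ι) fun i => (M i).U
  nonempty := ⟨Quotient.mk _ fun i => (M i).nonempty.some⟩
  zero := Quotient.mk _ fun i => (M i).zero
  succ := Quotient.map (fun f i => (M i).succ (f i)) fun _ _ h =>
    Eventually.mono h fun i hi => congrArg (M i).succ hi
  add := Quotient.map₂ (fun f g i => (M i).add (f i) (g i)) fun _ _ h _ _ h' =>
    Eventually.mono (Eventually.and h h') fun i hi => congrArg₂ (M i).add hi.1 hi.2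
  mul := Quotient.map₂ (fun f g i => (M i).mul (f i) (g i)) fun _ _ h _ _ h' =>
    Eventually.mono (Eventually.and h h') fun i hi => congrArg₂ (M i).mul hi.1 hi.2
  satK := fun s φ => ∀ᶠ i in (F : Filter ι), (M i).satK (fun n => (s n).out i) φ

namespace LStructure

theorem isLStructure_ultraproduct {ι : Type} (F : Ultrafilter ι) (M : ι → LStructure)
    (hM : ∀ i, IsLStructure (M i)) : IsLStructure (ultraproduct F M) := by
  refine ⟨fun φ s t h => ?_, fun φ ψ s h => ?_, fun φ x y s h => ?_⟩
  · refine Filter.eventually_congr (Filter.Eventually.of_forall fun i => ?_)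
    exact (hM i).1 φ _ _ fun x hx => by rw [h x hx]
  · exact Filter.eventually_congr (Filter.Eventually.of_forall fun i => (hM i).2.1 φ ψ _ h)
  · refine Filter.eventually_congr (Filter.Eventually.of_forall fun i => ?_)
    rw [(hM i).2.2 φ x y _ h]
    refine iff_of_eq (congrArg (fun s => (M i).satK s φ) (funext fun n => ?_))
    by_cases hn : n = x
    · subst hn
      simp
    · simp [Function.update_of_ne hn]

theorem evalT_ultraproduct {ι : Type} (F : Ultrafilter ι) (M : ι → LStructure)
    (s : ℕ → ∀ i, (M i).U) (t : LTerm) :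
    (ultraproduct F M).evalT (fun n => Quotient.mk _ (s n)) t =
      Quotient.mk _ fun i => (M i).evalT (fun n => s n i) t := by
  induction t with
  | var n => rfl
  | zero => rfl
  | succ t ih => simp only [evalT, ih]; rfl
  | add t u iht ihu => simp only [evalT, iht, ihu]; rfl
  | mul t u iht ihu => simp only [evalT, iht, ihu]; rfl

/-- Łoś's theorem for structures with a modal operator. -/
theorem sat_ultraproduct {ι : Type} (F : Ultrafilter ι) (M : ι → LStructure)
    (hM : ∀ i, IsLStructure (M i)) (φ : LFormula) (s : ℕ → ∀ i, (M i).U) :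
    (ultraproduct F M).Sat (fun n => Quotient.mk _ (s n)) φ ↔
      ∀ᶠ i in (F : Filter ι), (M i).Sat (fun n => s n i) φ := by
  induction φ generalizing s with
  | eq t u =>
    simp only [Sat, evalT_ultraproduct]
    exact Quotient.eq
  | falsum => simp [Sat, F.neBot.ne]
  | imp a b iha ihb => simp only [Sat, iha, ihb, Ultrafilter.eventually_imp]
  | all x a ih =>
    have hupd (f : ∀ i, (M i).U) :
        (ultraproduct F M).Sat
            (Function.update (fun n => Quotient.mk _ (s n)) x (Quotient.mk _ f)) a ↔
          ∀ᶠ i in (F : Filter ι), (M i).Sat (Function.update (fun n => s n i) x (f i)) a := by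
      have h₁ : Function.update (β := fun _ => (ultraproduct F M).U)
          (fun n => Quotient.mk _ (s n)) x (Quotient.mk _ f) =
          fun n => Quotient.mk _ (Function.update s x f n) := by
        funext n
        by_cases hn : n = x
        · subst hn
          rw [Function.update_self]
          exact Function.update_self ..
        · rw [Function.update_of_ne hn]
          exact Function.update_of_ne hn ..
      have h₂ (i : ι) : Function.update (fun n => s n i) x (f i) =
          fun n => Function.update s x f n i := by
        funext n
        by_cases hn : n = x
        · subst hn
          simp
        · simp [Function.update_of_ne hn]
      simp only [h₂]
      rw [← ih]
      exact iff_of_eq (congrArg (fun s => (ultraproduct F M).Sat s a) h₁)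
    constructor
    · intro h
      by_contra hc
      rw [← Ultrafilter.eventually_not] at hc
      have hw (i : ι) : ∃ u, ¬ (M i).Sat (fun n => s n i) (.all x a) →
          ¬ (M i).Sat (Function.update (fun n => s n i) x u) a := by
        by_cases hi : (M i).Sat (fun n => s n i) (.all x a)
        · exact ⟨(M i).nonempty.some, fun h => absurd hi h⟩
        · obtain ⟨u, hu⟩ := not_forall.mp hi
          exact ⟨u, fun _ => hu⟩
      choose f hf using hw
      obtain ⟨i, hi, hi'⟩ := (hc.and ((hupd f).mp (h _))).exists
      exact hf i hi hi'
    · intro h u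
      obtain ⟨f, rfl⟩ := Quotient.exists_rep u
      exact (hupd f).mpr (h.mono fun i hi => hi (f i))
  | K a =>
    have hout : ∀ᶠ i in (F : Filter ι), ∀ n ∈ a.fv,
        (Quotient.mk (Filter.productSetoid (F : Filter ι) fun i => (M i).U) (s n)).out i = s n i :=
      (Filter.eventually_all_finset _).mpr fun n _ =>
        Quotient.mk_out (s := Filter.productSetoid (F : Filter ι) fun i => (M i).U) (s n)
    exact Filter.eventually_congr (hout.mono fun i hi => (hM i).1 a _ _ hi)

theorem evalT_congr (M : LStructure) {s t : ℕ → M.U} (u : LTerm) (h : ∀ x ∈ u.fv, s x = t x) :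
    M.evalT s u = M.evalT t u := by
  induction u with
  | var n => exact h n (by simp [LTerm.fv])
  | zero => rfl
  | succ u ih => exact congrArg M.succ (ih h)
  | add u v ihu ihv =>
    exact congrArg₂ M.add (ihu fun x hx => h x (Finset.mem_union_left _ hx))
      (ihv fun x hx => h x (Finset.mem_union_right _ hx))
  | mul u v ihu ihv =>
    exact congrArg₂ M.mul (ihu fun x hx => h x (Finset.mem_union_left _ hx))
      (ihv fun x hx => h x (Finset.mem_union_right _ hx))

theorem sat_congr {M : LStructure} (hM : IsLStructure M) (φ : LFormula) {s t : ℕ → M.U}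
    (h : ∀ x ∈ φ.fv, s x = t x) : M.Sat s φ ↔ M.Sat t φ := by
  induction φ generalizing s t with
  | eq u v =>
    simp only [Sat]
    rw [M.evalT_congr u fun x hx => h x (Finset.mem_union_left _ hx),
      M.evalT_congr v fun x hx => h x (Finset.mem_union_right _ hx)]
  | falsum => rfl
  | imp a b iha ihb =>
    exact imp_congr (iha fun x hx => h x (Finset.mem_union_left _ hx))
      (ihb fun x hx => h x (Finset.mem_union_right _ hx))
  | all x a ih =>
    refine forall_congr' fun u => ih fun y hy => ?_
    by_cases hyx : y = x
    · subst hyx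
      simp
    · simpa [Function.update_of_ne hyx] using h y (Finset.mem_erase.mpr ⟨hyx, hy⟩)
  | K a => exact hM.1 a s t h

theorem models_of_sat {M : LStructure} (hM : IsLStructure M) {φ : LFormula} (hφ : φ.fv = ∅)
    {s : ℕ → M.U} (h : M.Sat s φ) : M.Models φ := fun t =>
  (sat_congr hM φ (by simp [hφ])).mp h

theorem models_all_iff (M : LStructure) (x : ℕ) (φ : LFormula) :
    M.Models (.all x φ) ↔ M.Models φ :=
  ⟨fun h s => by simpa using h s (s x), fun h _ _ => h _⟩

theorem models_uclose_iff (M : LStructure) (φ : LFormula) :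
    M.Models (uclose φ) ↔ M.Models φ := by
  unfold uclose
  induction φ.fv.sort (· ≤ ·) with
  | nil => rfl
  | cons x l ih => rw [List.foldr_cons, models_all_iff, ih]

end LStructure

/-- The compactness theorem for consequence. -/
theorem Consequence.exists_finset {T : Set LFormula} {φ : LFormula} (h : Consequence T φ) :
    ∃ S : Finset LFormula, ↑S ⊆ T ∧ Consequence S φ := by
  classical
  by_contra! hc
  have hw (S : Finset T) : ∃ M : LStructure, IsLStructure M ∧ (∀ σ ∈ S, M.Models σ.1) ∧
      ∃ s : ℕ → M.U, ¬ M.Sat s φ := by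
    have hS := hc (S.image Subtype.val) (by simp)
    simp only [Consequence, not_forall, exists_prop] at hS
    obtain ⟨M, hM, hMS, hφ⟩ := hS
    exact ⟨M, hM, fun σ hσ => hMS _ (by simpa using hσ), not_forall.mp hφ⟩
  choose M hM hMS s hs using hw
  let F : Ultrafilter (Finset T) := Ultrafilter.of Filter.atTop
  have hF : (F : Filter (Finset T)) ≤ Filter.atTop := Ultrafilter.of_le _
  have key := h (LStructure.ultraproduct F M) (LStructure.isLStructure_ultraproduct F M hM) ?_
    fun n => Quotient.mk _ fun S => s S n
  · rw [LStructure.sat_ultraproduct F M hM φ fun n S => s S n] at key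
    obtain ⟨S, hS⟩ := key.exists
    exact hs S hS
  · intro σ hσ t
    have ht : t = fun n => Quotient.mk _ (t n).out := funext fun n => (Quotient.out_eq _).symm
    rw [ht]
    refine (LStructure.sat_ultraproduct F M hM σ _).mpr ?_
    have hmem : ∀ᶠ S in (F : Filter (Finset T)), {⟨σ, hσ⟩} ≤ S :=
      hF (Filter.eventually_ge_atTop _)
    refine hmem.mono fun S hS => ?_
    exact hMS S ⟨σ, hσ⟩ (Finset.singleton_subset_iff.mp hS) _

/-- The nested implication with antecedents `l` and conclusion `φ` is valid whenever the
sentences in `l` entail `φ`. -/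
theorem Consequence.valid_foldr_imp {l : List LFormula} {φ : LFormula}
    (hl : ∀ σ ∈ l, σ.fv = ∅) (h : Consequence {σ | σ ∈ l} φ) : Valid (l.foldr .imp φ) := by
  intro M hM _ s
  have hfold (l : List LFormula) : M.Sat s (l.foldr .imp φ) ↔
      ((∀ σ ∈ l, M.Sat s σ) → M.Sat s φ) := by
    induction l with
    | nil => simp
    | cons σ l ih => simp [LStructure.Sat, ih]
  exact (hfold l).mpr fun hs =>
    h M hM (fun σ hσ => LStructure.models_of_sat hM (hl σ hσ) (hs σ hσ)) s

theorem LStructure.models_K_of_foldr_imp {M : LStructure} (hE2 : ∀ χ ∈ E2set, M.Models χ)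
    {l : List LFormula} {φ : LFormula} (hl : ∀ σ ∈ l, M.Models (.K σ))
    (h : M.Models (.K (l.foldr .imp φ))) : M.Models (.K φ) := by
  induction l with
  | nil => exact h
  | cons σ l ih =>
    refine ih (fun τ hτ => hl τ (List.mem_cons_of_mem _ hτ)) fun s => ?_
    exact (M.models_uclose_iff _).mp (hE2 _ ⟨σ, l.foldr .imp φ, rfl⟩) s (h s)
      (hl σ List.mem_cons_self s)

theorem Consequence.K_of_closed {T : Set LFormula} (hsent : ∀ σ ∈ T, σ.fv = ∅)
    (hclosed : ∀ φ ∈ T, LFormula.K φ ∈ T) (hE1 : E1set ⊆ T) (hE2 : E2set ⊆ T)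
    {φ : LFormula} (h : Consequence T φ) : Consequence T (.K φ) := by
  obtain ⟨S, hST, hS⟩ := h.exists_finset
  have hmem : ∀ σ ∈ S.toList, σ ∈ T := fun σ hσ => hST (Finset.mem_toList.mp hσ)
  have hvalid : Valid (S.toList.foldr .imp φ) :=
    Consequence.valid_foldr_imp (fun σ hσ => hsent σ (hmem σ hσ)) (by simpa using hS)
  intro M hM hMT
  exact M.models_K_of_foldr_imp (fun χ hχ => hMT χ (hE2 hχ))
    (fun σ hσ => hMT _ (hclosed σ (hmem σ hσ)))
    ((M.models_uclose_iff _).mp (hMT _ (hE1 ⟨_, hvalid, rfl⟩)))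

/-- If Σ is a set of 𝓛-sentences closed under K and containing all
instances of E1 and E2, then M_Σ satisfies all instances of E4 (the universal
closure of K φ → K K φ). -/
theorem MSigma_satisfies_E4 (T : Set LFormula) (hsent : ∀ σ ∈ T, σ.fv = ∅)
    (hclosed : ∀ φ ∈ T, LFormula.K φ ∈ T)
    (hE1 : E1set ⊆ T) (hE2 : E2set ⊆ T) :
    ∀ χ ∈ E4set, (MSigma T).Models χ := by
  rintro χ ⟨φ, rfl⟩
  rw [LStructure.models_uclose_iff]
  exact fun s h => Consequence.K_of_closed hsent hclosed hE1 hE2 h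
end
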